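/- arXiv:2501.16827 — 7 statements merged into one kernel-verified Lean document; each statement's English description precedes it below -/
import Mathlib

section
/- For all natural numbers a and b, the binary parity-check matrices of the quantum XYZ cyclic code C(a,b) satisfy the symplectic orthogonality condition H_x · H_zᵀ + H_z · H_xᵀ = 0 over F_2 (equivalently H_x · H_zᵀ = H_z · H_xᵀ); hence the stabilizer group of C(a,b) is Abelian. -/
open Matrix

instance (n : ℕ) : NeZero (2 * n + 7) := ⟨by omega⟩

/-- The circulant parity-check matrix `H_x` of the quantum XYZ cyclic code `C(a,b)`,
whose symbol is the indicator function of `{0, a+b+2, a+b+4, 2(a+b)+6} ⊆ ZMod (2(a+b)+7)`. -/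
def Hx (a b : ℕ) : Matrix (ZMod (2 * (a + b) + 7)) (ZMod (2 * (a + b) + 7)) (ZMod 2) :=
  Matrix.circulant fun i =>
    if i ∈ ({((0 : ℕ) : ZMod (2 * (a + b) + 7)), ((a + b + 2 : ℕ) : ZMod (2 * (a + b) + 7)),
        ((a + b + 4 : ℕ) : ZMod (2 * (a + b) + 7)),
        ((2 * (a + b) + 6 : ℕ) : ZMod (2 * (a + b) + 7))} : Finset (ZMod (2 * (a + b) + 7)))
    then 1 else 0

/-- The circulant parity-check matrix `H_z` of the quantum XYZ cyclic code `C(a,b)`,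
whose symbol is the indicator function of `{b+1, a+b+2, a+b+4, 2a+b+5} ⊆ ZMod (2(a+b)+7)`. -/
def Hz (a b : ℕ) : Matrix (ZMod (2 * (a + b) + 7)) (ZMod (2 * (a + b) + 7)) (ZMod 2) :=
  Matrix.circulant fun i =>
    if i ∈ ({((b + 1 : ℕ) : ZMod (2 * (a + b) + 7)), ((a + b + 2 : ℕ) : ZMod (2 * (a + b) + 7)),
        ((a + b + 4 : ℕ) : ZMod (2 * (a + b) + 7)),
        ((2 * a + b + 5 : ℕ) : ZMod (2 * (a + b) + 7))} : Finset (ZMod (2 * (a + b) + 7)))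
    then 1 else 0

/-- If two symbols are invariant under the same reflection `i ↦ k - i`, then the associated
circulant matrices satisfy `A * Bᵀ = B * Aᵀ`. -/
theorem circulant_mul_transpose_comm_of_reflection {G R : Type*} [AddCommGroup G] [Fintype G]
    [CommSemiring R] {f g : G → R} (k : G) (hf : ∀ i, f (k - i) = f i)
    (hg : ∀ i, g (k - i) = g i) :
    circulant f * (circulant g)ᵀ = circulant g * (circulant f)ᵀ := by
  ext i l
  simp only [mul_apply, transpose_apply, circulant_apply]
  refine Fintype.sum_equiv (Equiv.subLeft (i + l - k)) _ _ fun j => ?_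
  rw [← hf (i - j), ← hg (l - j), mul_comm, Equiv.subLeft_apply]
  congr 2 <;> abel

/-- The indicator function of `{p, q, r, s}` is invariant under the reflection `i ↦ k - i`
when `p + s = k` and `q + r = k`. -/
theorem indicator_reflection {G R : Type*} [AddCommGroup G] [DecidableEq G] [Zero R] [One R]
    {k p q r s : G} (hps : p + s = k) (hqr : q + r = k) (i : G) :
    (if k - i ∈ ({p, q, r, s} : Finset G) then (1 : R) else 0) =
      if i ∈ ({p, q, r, s} : Finset G) then 1 else 0 := by
  have key {x y : G} (h : x + y = k) : k - i = x ↔ i = y := by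
    rw [← h, sub_eq_iff_eq_add, add_right_inj, eq_comm]
  refine if_congr ?_ rfl rfl
  simp only [Finset.mem_insert, Finset.mem_singleton, key hps, key hqr,
    key ((add_comm s p).trans hps), key ((add_comm r q).trans hqr)]
  tauto

/-- For all natural numbers `a` and `b`, the binary parity-check matrices of the quantum XYZ
cyclic code `C(a,b)` satisfy the symplectic orthogonality condition
`H_x * H_zᵀ + H_z * H_xᵀ = 0` over `F_2`; hence the stabilizer group of `C(a,b)` is Abelian. -/
theorem xyz_cyclic_stabilizers_commute (a b : ℕ) :
    Hx a b * (Hz a b)ᵀ + Hz a b * (Hx a b)ᵀ = 0 := by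
  have hN : ((2 * (a + b) + 7 : ℕ) : ZMod (2 * (a + b) + 7)) = 0 := ZMod.natCast_self _
  push_cast at hN
  have hcomm : Hx a b * (Hz a b)ᵀ = Hz a b * (Hx a b)ᵀ := by
    refine circulant_mul_transpose_comm_of_reflection (-1)
      (indicator_reflection ?_ ?_) (indicator_reflection ?_ ?_) <;>
    · push_cast
      linear_combination hN
  rw [hcomm]
  ext i j
  exact CharTwo.add_self_eq_zero _
end

section
/- Let a and b be natural numbers and N = 2(a+b)+7. In F_2[X], let A = (1 + X^(a+b+2)) · (1 + X^(a+b+4)) and B = X^(b+1) · (1 + X^(a+1)) · (1 + X^(a+3)). Then the degree of gcd(gcd(A, B), X^N + 1) equals 3 if either (b ≡ 2 (mod 3) and a ≡ 2 (mod 3)) or (b ≡ 1 (mod 3) and a ≡ 0 (mod 3)), and equals 1 in all other cases. (This degree is the number of logical qubits encoded by the quantum XYZ cyclic code C(a,b).) -/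
open Polynomial

theorem X_pow_add_one_dvd_X_pow_sub_X_pow_mod (d n : ℕ) :
    (X ^ d + 1 : (ZMod 2)[X]) ∣ X ^ n - X ^ (n % d) := by
  have h : (X ^ d + 1 : (ZMod 2)[X]) ∣ (X ^ d) ^ (n / d) - 1 := by
    simpa [CharTwo.sub_eq_add] using sub_dvd_pow_sub_pow (X ^ d : (ZMod 2)[X]) 1 (n / d)
  have e : (X ^ n - X ^ (n % d) : (ZMod 2)[X]) = X ^ (n % d) * ((X ^ d) ^ (n / d) - 1) := by
    conv_lhs => enter [1]; rw [← Nat.mod_add_div n d, pow_add, pow_mul]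
    ring
  rw [e]
  exact h.mul_left _

theorem dvd_X_pow_add_one_iff_mod {g : (ZMod 2)[X]} {d : ℕ} (hg : g ∣ X ^ d + 1) (n : ℕ) :
    g ∣ X ^ n + 1 ↔ g ∣ X ^ (n % d) + 1 := by
  have h := hg.trans (X_pow_add_one_dvd_X_pow_sub_X_pow_mod d n)
  rw [← sub_add_cancel (X ^ n : (ZMod 2)[X]) (X ^ (n % d)), add_assoc]
  exact dvd_add_right h

theorem squarefree_X_pow_add_one {n : ℕ} (hn : Odd n) :
    Squarefree (X ^ n + 1 : (ZMod 2)[X]) := by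
  rw [← CharTwo.sub_eq_add]
  refine (X_pow_sub_one_separable_iff.2 ?_).squarefree
  rw [ZMod.natCast_eq_one_iff_odd.2 hn]
  exact one_ne_zero

theorem X_add_one_dvd_X_pow_add_one (n : ℕ) : (X + 1 : (ZMod 2)[X]) ∣ X ^ n + 1 := by
  simpa [CharTwo.sub_eq_add] using sub_dvd_pow_sub_pow (X : (ZMod 2)[X]) 1 n

theorem X_add_one_sq : (X + 1 : (ZMod 2)[X]) ^ 2 = X ^ 2 + 1 := by
  rw [CharTwo.add_sq, one_pow]

theorem dvd_X_cube_add_one {g : (ZMod 2)[X]} {m : ℕ} (hsq : Squarefree g)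
    (hA : g ∣ (1 + X ^ m) * (1 + X ^ (m + 2))) (hN : g ∣ X ^ (2 * m + 3) + 1) :
    g ∣ X ^ 3 + 1 := by
  have two : (2 : (ZMod 2)[X]) = 0 := CharTwo.two_eq_zero
  have e₁ : (X ^ 3 + 1 : (ZMod 2)[X]) =
      (X ^ (2 * m + 3) + 1) + X ^ 3 * (1 + X ^ m) ^ 2 := by
    linear_combination (-(X ^ m) ^ 2 * X ^ 3 - X ^ m * X ^ 3) * two
  have e₂ : (X + 1 : (ZMod 2)[X]) =
      X * (X ^ (2 * m + 3) + 1) + (1 + X ^ (m + 2)) ^ 2 := by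
    linear_combination (-(X ^ m) ^ 2 * X ^ 4 - X ^ m * X ^ 2) * two
  have h : g ∣ (X ^ 3 + 1) * (X + 1) := by
    have e : ((X ^ 3 + 1) * (X + 1) : (ZMod 2)[X]) =
        (X ^ (2 * m + 3) + 1) * (X + 1 + X ^ 3 * (1 + X ^ m) ^ 2 * X) +
          ((1 + X ^ m) * (1 + X ^ (m + 2))) * (X ^ 3 * ((1 + X ^ m) * (1 + X ^ (m + 2)))) := by
      linear_combination (X + 1) * e₁ + X ^ 3 * (1 + X ^ m) ^ 2 * e₂
    rw [e]
    exact dvd_add (hN.mul_right _) (hA.mul_right _)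
  rw [← hsq.dvd_pow_iff_dvd two_ne_zero, pow_two]
  exact h.trans (mul_dvd_mul_left _ (X_add_one_dvd_X_pow_add_one 3))

/-- Let `N = 2(a+b)+7`. In `F_2[X]`, with `A = (1 + X^(a+b+2))(1 + X^(a+b+4))` and
`B = X^(b+1)(1 + X^(a+1))(1 + X^(a+3))`, the degree of `gcd(gcd A B, X^N + 1)` equals `3`
if either (`b ≡ 2 [MOD 3]` and `a ≡ 2 [MOD 3]`) or (`b ≡ 1 [MOD 3]` and `a ≡ 0 [MOD 3]`),
and equals `1` in all other cases. This degree is the number of logical qubits encoded by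
the quantum XYZ cyclic code `C(a,b)`. -/
theorem xyz_cyclic_code_dimension (a b : ℕ) :
    (gcd (gcd ((1 + (X : Polynomial (ZMod 2)) ^ (a + b + 2)) * (1 + X ^ (a + b + 4)))
          ((X : Polynomial (ZMod 2)) ^ (b + 1) * (1 + X ^ (a + 1)) * (1 + X ^ (a + 3))))
        ((X : Polynomial (ZMod 2)) ^ (2 * (a + b) + 7) + 1)).natDegree =
      if (b % 3 = 2 ∧ a % 3 = 2) ∨ (b % 3 = 1 ∧ a % 3 = 0) then 3 else 1 := by
  have hodd : Odd (2 * (a + b) + 7) := ⟨a + b + 3, by ring⟩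
  set G := gcd (gcd ((1 + (X : Polynomial (ZMod 2)) ^ (a + b + 2)) * (1 + X ^ (a + b + 4)))
          ((X : Polynomial (ZMod 2)) ^ (b + 1) * (1 + X ^ (a + 1)) * (1 + X ^ (a + 3))))
        ((X : Polynomial (ZMod 2)) ^ (2 * (a + b) + 7) + 1)
  have hA : G ∣ (1 + X ^ (a + b + 2)) * (1 + X ^ (a + b + 4)) :=
    (gcd_dvd_left _ _).trans (gcd_dvd_left _ _)
  have hB : G ∣ X ^ (b + 1) * (1 + X ^ (a + 1)) * (1 + X ^ (a + 3)) :=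
    (gcd_dvd_left _ _).trans (gcd_dvd_right _ _)
  have hN : G ∣ X ^ (2 * (a + b) + 7) + 1 := gcd_dvd_right _ _
  have hdvd {p : (ZMod 2)[X]} (h₁ : p ∣ (1 + X ^ (a + b + 2)) * (1 + X ^ (a + b + 4)))
      (h₂ : p ∣ X ^ (b + 1) * (1 + X ^ (a + 1)) * (1 + X ^ (a + 3)))
      (h₃ : p ∣ X ^ (2 * (a + b) + 7) + 1) : p ∣ G := dvd_gcd (dvd_gcd h₁ h₂) h₃
  clear_value G
  have hsq : Squarefree G := (squarefree_X_pow_add_one hodd).squarefree_of_dvd hN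
  have h₃ : G ∣ X ^ 3 + 1 := by
    refine dvd_X_cube_add_one (m := a + b + 2) hsq hA ?_
    rwa [show 2 * (a + b + 2) + 3 = 2 * (a + b) + 7 by ring]
  split_ifs with h
  · have key : ∀ n, n % 3 = 0 → (X ^ 3 + 1 : (ZMod 2)[X]) ∣ X ^ n + 1 := fun n hn => by
      rw [dvd_X_pow_add_one_iff_mod dvd_rfl, hn, pow_zero, CharTwo.add_self_eq_zero]
      exact dvd_zero _
    have hd : X ^ 3 + 1 ∣ G := by
      simp only [add_comm (1 : (ZMod 2)[X])] at hdvd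
      refine hdvd ((key (a + b + 2) (by lia)).mul_right _) ?_ (key _ (by lia))
      rcases h with h | h
      · exact ((key (a + 1) (by lia)).mul_left _).mul_right _
      · exact (key (a + 3) (by lia)).mul_left _
    rw [natDegree_eq_of_degree_eq (degree_eq_degree_of_associated (associated_of_dvd_dvd h₃ hd))]
    exact natDegree_X_pow_add_C (r := 1)
  · have h₁ : G ∣ X + 1 := by
      by_cases hm : (a + b + 2) % 3 = 0
      · have hcop : IsCoprime G (X ^ (b + 1)) :=
          (IsCoprime.of_isCoprime_of_dvd_left ⟨1, -X ^ 2, by ring⟩ h₃).pow_right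
        rw [mul_assoc] at hB
        have hcube : G ∣ (X + 1) ^ 3 := by
          have k₁ := h₃.trans (X_pow_add_one_dvd_X_pow_sub_X_pow_mod 3 (a + 1))
          have k₂ := h₃.trans (X_pow_add_one_dvd_X_pow_sub_X_pow_mod 3 (a + 3))
          rw [show (a + 1) % 3 = 2 by lia] at k₁
          rw [show (a + 3) % 3 = 1 by lia] at k₂
          have e : ((X + 1) ^ 3 : (ZMod 2)[X]) = (1 + X ^ (a + 1)) * (1 + X ^ (a + 3)) -
              ((X ^ (a + 1) - X ^ 2) * (1 + X ^ (a + 3)) +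
                (X ^ (a + 3) - X ^ 1) * (X ^ 2 + 1)) := by
            linear_combination (X + 1) * X_add_one_sq
          rw [e]
          exact dvd_sub (hcop.dvd_of_dvd_mul_left hB)
            (dvd_add (k₁.mul_right _) (k₂.mul_right _))
        rwa [hsq.dvd_pow_iff_dvd three_ne_zero] at hcube
      · rw [dvd_X_pow_add_one_iff_mod h₃] at hN
        have : (2 * (a + b) + 7) % 3 = 1 ∨ (2 * (a + b) + 7) % 3 = 2 := by lia
        rcases this with h | h <;> rw [h] at hN
        · simpa using hN
        · rwa [← X_add_one_sq, hsq.dvd_pow_iff_dvd two_ne_zero] at hN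
    have hd : X + 1 ∣ G := by
      have key := X_add_one_dvd_X_pow_add_one
      simp only [add_comm (1 : (ZMod 2)[X])] at hdvd
      exact hdvd ((key _).mul_right _) ((key _).mul_left _) (key _)
    rw [natDegree_eq_of_degree_eq (degree_eq_degree_of_associated (associated_of_dvd_dvd h₁ hd))]
    exact natDegree_X_add_C 1
end

section
/- Let R be a commutative ring, let T and k be natural numbers with k ≥ 1, and set N = k·T. Let c, v : ZMod N → R, and suppose v is T-periodic, i.e. v (i + T) = v i for every i : ZMod N (where T is cast into ZMod N). Then the row vector v ᵥ* Matrix.circulant c is also T-periodic: for every j : ZMod N, (v ᵥ* Matrix.circulant c) (j + T) = (v ᵥ* Matrix.circulant c) j. -/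
open Matrix

/-- Multiplying a row vector by a circulant matrix preserves every period of the vector. -/
theorem Matrix.vecMul_circulant_add_of_periodic {G R : Type*} [AddCommGroup G] [Fintype G]
    [NonUnitalNonAssocSemiring R] {c v : G → R} {t : G} (hv : Function.Periodic v t) (j : G) :
    (v ᵥ* circulant c) (j + t) = (v ᵥ* circulant c) j := by
  simp only [vecMul, dotProduct, circulant_apply]
  rw [← Equiv.sum_comp (Equiv.addRight t)]
  simp [hv _]

/-- Let `R` be a commutative ring, `T, k` natural numbers with `k ≥ 1`, and `N = k·T`.
If `v : ZMod N → R` is `T`-periodic, then the row vector `v ᵥ* Matrix.circulant c` is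
also `T`-periodic. This is the key lemma used to analyze products of stabilizer
generators of quantum XYZ cyclic codes of length `N = k·T` selected at intervals of `T`. -/
theorem vecMul_circulant_periodic {R : Type*} [CommRing R] (T k : ℕ) [NeZero (k * T)]
    (hk : 1 ≤ k) (c v : ZMod (k * T) → R)
    (hv : ∀ i : ZMod (k * T), v (i + (T : ZMod (k * T))) = v i) :
    ∀ j : ZMod (k * T),
      (v ᵥ* Matrix.circulant c) (j + (T : ZMod (k * T))) = (v ᵥ* Matrix.circulant c) j := by
  exact vecMul_circulant_add_of_periodic hv
end

section
/- Let a and b be natural numbers and N = 2(a+b)+7. If gcd(a+b+2, N) = 1 and gcd(a+b+4, N) = 1, then the kernel of the circulant matrix H_x over F_2 consists exactly of the zero vector and the all-ones vector: for every v : ZMod N → F_2 with H_x *ᵥ v = 0, either v = 0 or v i = 1 for all i. (Thus the quantum XYZ cyclic code C(a,b) has repetition code structure under pure Pauli Z noise.) -/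
open Matrix

theorem circulant_indicator_mulVec {G R : Type*} [AddCommGroup G] [Fintype G] [DecidableEq G]
    [NonAssocSemiring R] (S : Finset G) (v : G → R) (i : G) :
    (Matrix.circulant (fun g => if g ∈ S then (1 : R) else 0) *ᵥ v) i = ∑ s ∈ S, v (i - s) := by
  simp only [Matrix.mulVec, dotProduct, Matrix.circulant_apply, ite_mul, one_mul, zero_mul]
  rw [← (Equiv.subLeft i).sum_comp]
  simp

theorem Function.Periodic.eq_of_isUnit {n : ℕ} [NeZero n] {α : Type*} {f : ZMod n → α}
    {p : ZMod n} (hf : Function.Periodic f p) (hp : IsUnit p) (i : ZMod n) : f i = f 0 := by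
  obtain ⟨u, rfl⟩ := hp
  have h := hf.nsmul_eq (i * ↑u⁻¹ : ZMod n).val
  simpa [nsmul_eq_mul, mul_assoc] using h

/-- Over `ZMod 2`, on a cycle of odd length `n`, the operator `(1 + T^p)(1 + T^q)`, with `T` the
cyclic shift and `p`, `q` units modulo `n`, only annihilates constant functions. -/
theorem eq_apply_zero_of_shift_product {n : ℕ} [NeZero n] (hn : Odd n) {p q : ZMod n}
    (hp : IsUnit p) (hq : IsUnit q) {v : ZMod n → ZMod 2}
    (hv : ∀ i, v i + v (i - p) + v (i - q) + v (i - (p + q)) = 0) (i : ZMod n) : v i = v 0 := by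
  set w : ZMod n → ZMod 2 := fun i => v (i + q) + v i with hw
  have w_periodic : Function.Periodic w p := fun i => by
    have h := hv (i + p + q)
    rw [show i + p + q - p = i + q by ring, show i + p + q - q = i + p by ring,
      show i + p + q - (p + q) = i by ring] at h
    simp only [hw]
    have two : (2 : ZMod 2) = 0 := by decide
    linear_combination h - (v (i + q) + v i) * two
  have w_const := w_periodic.eq_of_isUnit hp
  have w_sum : ∑ i, w i = 0 := by
    simp only [hw, Finset.sum_add_distrib]
    rw [show ∑ i, v (i + q) = ∑ i, v i from Equiv.sum_comp (Equiv.addRight q) v]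
    exact CharTwo.add_self_eq_zero _
  have w_zero : w 0 = 0 := by
    simpa [w_const, (ZMod.natCast_eq_one_iff_odd).2 hn] using w_sum
  have v_periodic : Function.Periodic v q := fun i =>
    CharTwo.add_eq_zero.1 ((w_const i).trans w_zero)
  exact v_periodic.eq_of_isUnit hq i

theorem Hx_mulVec_apply (a b : ℕ) (v : ZMod (2 * (a + b) + 7) → ZMod 2)
    (i : ZMod (2 * (a + b) + 7)) :
    (Hx a b *ᵥ v) i = v i + v (i - (a + b + 2 : ℕ)) + v (i - (a + b + 4 : ℕ)) +
      v (i - ((a + b + 2 : ℕ) + (a + b + 4 : ℕ))) := by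
  have natCast_ne {k l : ℕ} (hk : k < 2 * (a + b) + 7) (hl : l < 2 * (a + b) + 7) (h : k ≠ l) :
      (k : ZMod (2 * (a + b) + 7)) ≠ l := by
    rwa [Ne, ZMod.natCast_eq_natCast_iff', Nat.mod_eq_of_lt hk, Nat.mod_eq_of_lt hl]
  rw [Hx, circulant_indicator_mulVec, Finset.sum_insert, Finset.sum_insert, Finset.sum_insert,
    Finset.sum_singleton, Nat.cast_zero, sub_zero, ← Nat.cast_add,
    show a + b + 2 + (a + b + 4) = 2 * (a + b) + 6 by ring]
  · ring
  all_goals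
    simp only [Finset.mem_insert, Finset.mem_singleton, not_or]
    and_intros <;> exact natCast_ne (by omega) (by omega) (by omega)

/-- If `gcd(a+b+2, N) = 1` and `gcd(a+b+4, N) = 1` (`N = 2(a+b)+7`), the kernel of `H_x`
over `F_2` consists exactly of the zero vector and the all-ones vector: the quantum XYZ
cyclic code `C(a,b)` has repetition code structure under pure Pauli `Z` noise. -/
theorem xyz_repetition_structure_pauliZ (a b : ℕ)
    (h1 : Nat.gcd (a + b + 2) (2 * (a + b) + 7) = 1)
    (h2 : Nat.gcd (a + b + 4) (2 * (a + b) + 7) = 1) :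
    ∀ v : ZMod (2 * (a + b) + 7) → ZMod 2,
      Hx a b *ᵥ v = 0 → v = 0 ∨ ∀ i, v i = 1 := by
  intro v hv
  have v_const := eq_apply_zero_of_shift_product ((even_two_mul (a + b)).add_odd (by decide : Odd 7))
    ((ZMod.isUnit_iff_coprime _ _).2 h1) ((ZMod.isUnit_iff_coprime _ _).2 h2)
    fun i => (Hx_mulVec_apply a b v i).symm.trans (congrFun hv i)
  have zero_or_one : ∀ x : ZMod 2, x = 0 ∨ x = 1 := by decide
  exact (zero_or_one (v 0)).imp (fun h => funext fun i => (v_const i).trans h)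
    fun h i => (v_const i).trans h
end

section
/- Let N be an odd natural number and let p, q ≥ 1 be natural numbers with gcd(p, N) = 1 and gcd(q, N) = 1. Then in F_2[X], the degree of gcd((X^p + 1)·(X^q + 1), X^N + 1) equals 1 (indeed the gcd is X + 1). -/
open Polynomial

theorem dvd_pow_gcd_sub_one {R : Type*} [CommRing R] {r a : R} {m n : ℕ}
    (hm : r ∣ a ^ m - 1) (hn : r ∣ a ^ n - 1) : r ∣ a ^ Nat.gcd m n - 1 := by
  have key (k : ℕ) : r ∣ a ^ k - 1 ↔ Ideal.Quotient.mk (Ideal.span {r}) a ^ k = 1 := by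
    rw [← Ideal.mem_span_singleton, ← Ideal.Quotient.eq, map_pow, map_one]
  rw [key] at *
  exact pow_gcd_eq_one.2 ⟨hm, hn⟩

theorem isCoprime_X_pow_sub_one_geom_sum {F : Type*} [Field F] {N p : ℕ} (hN : (N : F) ≠ 0)
    (hpN : Nat.gcd p N = 1) :
    IsCoprime ((X : F[X]) ^ p - 1) (∑ i ∈ Finset.range N, X ^ i) := by
  have hgeom : (∑ i ∈ Finset.range N, (X : F[X]) ^ i) * (X - 1) = X ^ N - 1 := geom_sum_mul X N
  have hsep := X_pow_sub_one_separable_iff.2 hN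
  have hne : (∑ i ∈ Finset.range N, (X : F[X]) ^ i) ≠ 0 := by
    intro h
    rw [← hgeom, h, zero_mul] at hsep
    exact hsep.ne_zero rfl
  rw [← hgeom] at hsep
  refine isCoprime_of_irreducible_dvd (fun h => hne h.2) fun r hr hrp hrC => ?_
  have hrX : r ∣ X - 1 := by
    simpa [hpN] using dvd_pow_gcd_sub_one hrp (hgeom ▸ hrC.mul_right _ : r ∣ X ^ N - 1)
  exact hr.not_isUnit (hsep.isCoprime.isUnit_of_dvd' hrC hrX)

theorem dvd_X_sub_one_of_dvd_mul_of_dvd {F : Type*} [Field F] {N p q : ℕ} (hN : (N : F) ≠ 0)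
    (hpN : Nat.gcd p N = 1) (hqN : Nat.gcd q N = 1) {d : F[X]}
    (hd : d ∣ (X ^ p - 1) * (X ^ q - 1)) (hdN : d ∣ X ^ N - 1) : d ∣ X - 1 := by
  rw [← geom_sum_mul] at hdN
  exact (((isCoprime_X_pow_sub_one_geom_sum hN hpN).mul_left
    (isCoprime_X_pow_sub_one_geom_sum hN hqN)).of_isCoprime_of_dvd_left hd).dvd_of_dvd_mul_left hdN

/-- Let `N` be an odd natural number and `p, q ≥ 1` with `gcd(p, N) = 1` and
`gcd(q, N) = 1`. Then in `F_2[X]`, the gcd of `(X^p + 1)(X^q + 1)` and `X^N + 1` is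
`X + 1`; in particular its degree equals `1`. This is the key step in proving that a
quantum XYZ cyclic code has repetition code structure under a pure Pauli noise type. -/
theorem gcd_binomial_product_X_pow_add_one (N p q : ℕ) (hN : Odd N) (hp : 1 ≤ p)
    (hq : 1 ≤ q) (hpN : Nat.gcd p N = 1) (hqN : Nat.gcd q N = 1) :
    gcd (((X : Polynomial (ZMod 2)) ^ p + 1) * ((X : Polynomial (ZMod 2)) ^ q + 1))
        ((X : Polynomial (ZMod 2)) ^ N + 1) = X + 1 ∧
    (gcd (((X : Polynomial (ZMod 2)) ^ p + 1) * ((X : Polynomial (ZMod 2)) ^ q + 1))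
        ((X : Polynomial (ZMod 2)) ^ N + 1)).natDegree = 1 := by
  have hN2 : (N : ZMod 2) ≠ 0 := by
    rw [(ZMod.natCast_eq_one_iff_odd).2 hN]
    exact one_ne_zero
  have hgcd : gcd (((X : Polynomial (ZMod 2)) ^ p + 1) * ((X : Polynomial (ZMod 2)) ^ q + 1))
      ((X : Polynomial (ZMod 2)) ^ N + 1) = X + 1 := by
    simp only [← CharTwo.sub_eq_add]
    refine dvd_antisymm_of_normalize_eq ?_ ?_ ?_ ?_
    · exact normalize_gcd _ _
    · rw [← C_1, (monic_X_sub_C (1 : ZMod 2)).normalize_eq_self]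
    · exact dvd_X_sub_one_of_dvd_mul_of_dvd hN2 hpN hqN (gcd_dvd_left _ _) (gcd_dvd_right _ _)
    · exact dvd_gcd ((sub_one_dvd_pow_sub_one X p).mul_right _) (sub_one_dvd_pow_sub_one X N)
  refine ⟨hgcd, ?_⟩
  rw [hgcd, ← C_1, natDegree_X_add_C]
end

section
/- Let b be a natural number, l ≥ 1, a = 2l(b+2) + l − 1, and N = 2(a+b)+7 (so N = (2l+1)(2b+5)). Let v : ZMod N → F_2 be the indicator function of the set of residues {(b+2) + j·(2b+5) : 0 ≤ j ≤ 2l} in ZMod N. Then: (i) H_z *ᵥ v = 0; (ii) v has Hamming weight 2l+1 (which is odd); and (iii) every w : ZMod N → F_2 satisfying H_z *ᵥ w = 0 and having odd Hamming weight has Hamming weight at least 2l+1. In other words, the minimum weight of an X-type logical operator of the quantum XYZ cyclic code C(a,b) is exactly 2l+1. -/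
open Matrix

/-- The Hamming weight of a vector `v : ZMod N → F_2`: the number of indices `i`
with `v i ≠ 0`. -/
def hammingWt {N : ℕ} [NeZero N] (v : ZMod N → ZMod 2) : ℕ :=
  (Finset.univ.filter fun i => v i ≠ 0).card

theorem Hz_mulVec_apply (a b : ℕ) (w : ZMod (2 * (a + b) + 7) → ZMod 2)
    (i : ZMod (2 * (a + b) + 7)) :
    (Hz a b *ᵥ w) i = w (i - (b + 1 : ℕ)) + w (i - (a + b + 2 : ℕ)) + w (i - (a + b + 4 : ℕ)) +
      w (i - (2 * a + b + 5 : ℕ)) := by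
  have hne : ∀ x y : ℕ, x < 2 * (a + b) + 7 → y < 2 * (a + b) + 7 → x ≠ y →
      (x : ZMod (2 * (a + b) + 7)) ≠ y := by
    intro x y hx hy hxy h
    rw [ZMod.natCast_eq_natCast_iff'] at h
    rw [Nat.mod_eq_of_lt hx, Nat.mod_eq_of_lt hy] at h
    exact hxy h
  rw [Matrix.mulVec_eq_sum, Finset.sum_apply]
  rw [← (Equiv.subLeft i).sum_comp]
  simp only [Hz, Matrix.circulant_apply, Equiv.subLeft_apply, Pi.smul_apply, Matrix.transpose_apply,
    sub_sub_cancel, op_smul_eq_smul, smul_eq_mul, mul_ite, mul_one, mul_zero, Finset.sum_ite_mem,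
    Finset.univ_inter]
  rw [Finset.sum_insert, Finset.sum_insert, Finset.sum_insert, Finset.sum_singleton]
  · ring
  all_goals
    simp only [Finset.mem_insert, Finset.mem_singleton, not_or]
    repeat' apply And.intro
    all_goals exact hne _ _ (by omega) (by omega) (by omega)

/-- Membership in `{c + j * m : j < L} ⊆ ZMod (L * m)` does not require the bound on `j`. -/
theorem mem_image_range_natCast_iff {N L m : ℕ} (c : ℕ) (hL : 0 < L) (hN : N = L * m) (i : ZMod N) :
    i ∈ (Finset.range L).image (fun j => ((c + j * m : ℕ) : ZMod N)) ↔
      ∃ j : ℕ, i = ((c + j * m : ℕ) : ZMod N) := by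
  simp only [Finset.mem_image, Finset.mem_range]
  refine ⟨fun ⟨j, _, h⟩ => ⟨j, h.symm⟩, fun ⟨j, h⟩ => ⟨j % L, Nat.mod_lt _ hL, ?_⟩⟩
  rw [h, ZMod.natCast_eq_natCast_iff]
  refine Nat.ModEq.add_left _ ?_
  rw [hN]
  exact (Nat.mod_modEq j L).mul_right' m

theorem add_mem_image_range_natCast_iff {N L m : ℕ} (c k : ℕ) (hk : k ≤ L) (hL : 0 < L)
    (hN : N = L * m) (i : ZMod N) :
    i + ((k * m : ℕ) : ZMod N) ∈ (Finset.range L).image (fun j => ((c + j * m : ℕ) : ZMod N)) ↔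
      i ∈ (Finset.range L).image (fun j => ((c + j * m : ℕ) : ZMod N)) := by
  rw [mem_image_range_natCast_iff c hL hN, mem_image_range_natCast_iff c hL hN]
  constructor
  · rintro ⟨j, hj⟩
    refine ⟨j + (L - k), ?_⟩
    have h0 : ((k * m : ℕ) : ZMod N) + (((L - k) * m : ℕ) : ZMod N) = 0 := by
      rw [← Nat.cast_add, ← add_mul, Nat.add_sub_cancel' hk, ← hN, ZMod.natCast_self]
    calc i = i + ((k * m : ℕ) : ZMod N) + (((L - k) * m : ℕ) : ZMod N) := by
            rw [add_assoc, h0, add_zero]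
      _ = _ := by rw [hj]; push_cast; ring
  · rintro ⟨j, rfl⟩
    exact ⟨j + k, by push_cast; ring⟩

theorem hammingWt_indicator {N : ℕ} [NeZero N] (s : Finset (ZMod N)) :
    hammingWt (fun i => if i ∈ s then 1 else 0) = s.card := by
  simp [hammingWt]

/-- A set of positions on which `w` does not vanish, enumerated injectively, bounds the weight. -/
theorem le_hammingWt_of_injOn {N : ℕ} [NeZero N] {w : ZMod N → ZMod 2} {L : ℕ} (e : ℕ → ZMod N)
    (he : ∀ k, w (e k) ≠ 0) (hinj : Set.InjOn e (Finset.range L)) : L ≤ hammingWt w := by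
  have := Finset.card_le_card_of_injOn (s := Finset.range L)
    (t := Finset.univ.filter fun i => w i ≠ 0) e (fun k _ => by simpa using he k) hinj
  simpa [hammingWt] using this

/-- A nonzero vector with period `t` has weight at least the additive order of `t`. -/
theorem addOrderOf_le_hammingWt {N : ℕ} [NeZero N] {w : ZMod N → ZMod 2} {t i : ZMod N}
    (ht : ∀ j, w (j + t) = w j) (hi : w i ≠ 0) : addOrderOf t ≤ hammingWt w := by
  refine le_hammingWt_of_injOn (fun k => i + k • t) (fun k => ?_) ?_
  · induction k with
    | zero => simpa using hi
    | succ k ih => simpa [add_mul, ← add_assoc, ht] using ih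
  · intro x hx y hy h
    exact nsmul_injOn_Iio_addOrderOf (by simpa using hx) (by simpa using hy) (add_left_cancel h)

/-- If `w` differs from its translate by `t` at `i`, hence on the whole coset `i + ⟨m⟩`, where
`t ∉ ⟨m⟩`, then its weight is at least the size of that coset. -/
theorem le_hammingWt_of_ne_translate {N L m t : ℕ} [NeZero N] (hN : N = L * m) (hmt : ¬ m ∣ t)
    {w : ZMod N → ZMod 2} {i : ZMod N}
    (hper : ∀ j : ZMod N, w (j + m) + w (j + m + t) = w j + w (j + t))
    (hi : w i + w (i + t) ≠ 0) : L ≤ hammingWt w := by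
  have hk : ∀ k : ℕ, w (i + (k * m : ℕ)) + w (i + (k * m : ℕ) + t) ≠ 0 := by
    intro k
    induction k with
    | zero => simpa using hi
    | succ k ih =>
      have h := hper (i + (k * m : ℕ))
      rw [← h] at ih
      have e : i + ((k * m : ℕ) : ZMod N) + m = i + (((k + 1) * m : ℕ) : ZMod N) := by
        push_cast; ring
      rwa [e] at ih
  have hex : ∀ k : ℕ, ∃ ε : ℕ, ε < 2 ∧ w (i + (k * m + ε * t : ℕ)) ≠ 0 := by
    intro k
    by_cases h : w (i + (k * m : ℕ)) = 0
    · refine ⟨1, by norm_num, ?_⟩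
      have := hk k
      rw [h, zero_add] at this
      simpa [add_assoc] using this
    · exact ⟨0, by norm_num, by simpa using h⟩
  choose ε hε hw using hex
  have hm : 0 < m := by
    rcases Nat.eq_zero_or_pos m with rfl | h
    · exact absurd (by simpa using hN) (NeZero.ne N)
    · exact h
  refine le_hammingWt_of_injOn (fun k => i + (k * m + ε k * t : ℕ)) hw ?_
  intro x hx y hy hxy
  replace hxy := (ZMod.natCast_eq_natCast_iff _ _ _).1 (add_left_cancel hxy)
  have hmod : ε x * t ≡ ε y * t [MOD m] := by
    have := hxy.of_dvd (Dvd.intro_left L hN.symm)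
    simpa [Nat.ModEq, Nat.add_mod] using this
  have hεxy : ε x = ε y := by
    have h1 := hε x
    have h2 := hε y
    have h3 : ¬ (0 ≡ t [MOD m]) := fun h => hmt ((Nat.modEq_zero_iff_dvd).1 h.symm)
    interval_cases ε x <;> interval_cases ε y <;> simp_all
    exact h3 hmod.symm
  rw [hεxy] at hxy
  have := Nat.ModEq.add_right_cancel' _ hxy
  rw [hN] at this
  have := Nat.ModEq.mul_right_cancel' hm.ne' this
  exact this.eq_of_lt_of_lt (by simpa using hx) (by simpa using hy)

/-- Let `b` be a natural number, `l ≥ 1`, `a = 2l(b+2) + l − 1`, and `N = 2(a+b)+7`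
(so `N = (2l+1)(2b+5)`). Let `v` be the indicator vector of
`{(b+2) + j(2b+5) : 0 ≤ j ≤ 2l} ⊆ ZMod N`. Then (i) `H_z *ᵥ v = 0`; (ii) `v` has
Hamming weight `2l+1` (which is odd); and (iii) every `w` with `H_z *ᵥ w = 0` of odd
Hamming weight has Hamming weight at least `2l+1`. In other words, the minimum weight of
an `X`-type logical operator of the quantum XYZ cyclic code `C(a,b)` is exactly `2l+1`. -/
theorem xyz_min_weight_logical_X (b l : ℕ) (hl : 1 ≤ l) (a : ℕ)
    (ha : a = 2 * l * (b + 2) + l - 1) :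
    (Hz a b *ᵥ (fun i => if i ∈ (Finset.range (2 * l + 1)).image
        (fun j => (((b + 2) + j * (2 * b + 5) : ℕ) : ZMod (2 * (a + b) + 7))) then 1 else 0)
      = 0) ∧
    hammingWt (fun i => if i ∈ (Finset.range (2 * l + 1)).image
        (fun j => (((b + 2) + j * (2 * b + 5) : ℕ) : ZMod (2 * (a + b) + 7))) then 1 else 0)
      = 2 * l + 1 ∧
    Odd (2 * l + 1) ∧
    (∀ w : ZMod (2 * (a + b) + 7) → ZMod 2,
      Hz a b *ᵥ w = 0 → Odd (hammingWt w) → 2 * l + 1 ≤ hammingWt w) := by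
  have hN : 2 * (a + b) + 7 = (2 * l + 1) * (2 * b + 5) := by
    have : a + 1 = 2 * l * (b + 2) + l := by omega
    linarith
  have ha1 : a + 1 = l * (2 * b + 5) := by
    have : a + 1 = 2 * l * (b + 2) + l := by omega
    linarith
  have hzero : ((2 * (a + b) + 7 : ℕ) : ZMod (2 * (a + b) + 7)) = 0 := ZMod.natCast_self _
  refine ⟨?_, ?_, ⟨l, rfl⟩, ?_⟩
  · have hper (i) := add_mem_image_range_natCast_iff (b + 2) l (by omega) (by omega) hN i
    rw [← ha1] at hper
    funext i
    rw [Hz_mulVec_apply]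
    have e1 : i - ((b + 1 : ℕ) : ZMod (2 * (a + b) + 7)) =
        i - ((a + b + 2 : ℕ) : ZMod _) + ((a + 1 : ℕ) : ZMod _) := by push_cast; ring
    have e2 : i - ((a + b + 4 : ℕ) : ZMod (2 * (a + b) + 7)) =
        i - ((2 * a + b + 5 : ℕ) : ZMod _) + ((a + 1 : ℕ) : ZMod _) := by push_cast; ring
    simp only [e1, e2, hper]
    rw [CharTwo.add_self_eq_zero, zero_add, CharTwo.add_self_eq_zero, Pi.zero_apply]
  · rw [hammingWt_indicator, Finset.card_image_of_injOn, Finset.card_range]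
    have hlt : ∀ j ∈ Finset.range (2 * l + 1),
        b + 2 + j * (2 * b + 5) < 2 * (a + b) + 7 := by
      intro j hj
      have : j ≤ 2 * l := by simpa [Nat.lt_succ_iff] using hj
      have := Nat.mul_le_mul_right (2 * b + 5) this
      rw [hN, add_mul]
      omega
    intro x hx y hy hxy
    have h := (ZMod.natCast_eq_natCast_iff _ _ _).1 hxy
    have h := h.eq_of_lt_of_lt (hlt x hx) (hlt y hy)
    exact Nat.eq_of_mul_eq_mul_right (by omega) (Nat.add_left_cancel h)
  · intro w hw hodd
    have hsym (j : ZMod (2 * (a + b) + 7)) :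
        w (j + (a + 1 : ℕ)) + w (j + (a + 1 : ℕ) + (a + 3 : ℕ)) = w j + w (j + (a + 3 : ℕ)) := by
      have h := congrFun hw (j + (2 * a + b + 5 : ℕ))
      rw [Hz_mulVec_apply, Pi.zero_apply] at h
      have e1 : j + (2 * a + b + 5 : ℕ) - ((b + 1 : ℕ) : ZMod (2 * (a + b) + 7)) =
        j + (a + 1 : ℕ) + (a + 3 : ℕ) := by push_cast; ring
      have e2 : j + (2 * a + b + 5 : ℕ) - ((a + b + 2 : ℕ) : ZMod (2 * (a + b) + 7)) =
        j + (a + 3 : ℕ) := by push_cast; ring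
      have e3 : j + (2 * a + b + 5 : ℕ) - ((a + b + 4 : ℕ) : ZMod (2 * (a + b) + 7)) =
        j + (a + 1 : ℕ) := by push_cast; ring
      rw [e1, e2, e3, add_sub_cancel_right] at h
      rw [← CharTwo.add_eq_zero]
      linear_combination h
    by_cases ht : ∀ j, w (j + (a + 3 : ℕ)) = w j
    · obtain ⟨i, hi⟩ : ∃ i, w i ≠ 0 := by
        by_contra! h
        simp [hammingWt, h] at hodd
      refine le_trans ?_ (addOrderOf_le_hammingWt ht hi)
      rw [ZMod.addOrderOf_coe _ (NeZero.ne _)]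
      have hpos : 0 < (2 * (a + b) + 7).gcd (a + 3) := Nat.gcd_pos_of_pos_left _ (by omega)
      have hdvd : (2 * (a + b) + 7).gcd (a + 3) ∣ 2 * b + 1 := by
        rw [← Nat.dvd_add_right ((Nat.gcd_dvd_right _ _).mul_left 2)]
        convert Nat.gcd_dvd_left (2 * (a + b) + 7) (a + 3) using 1
        ring
      rw [Nat.le_div_iff_mul_le hpos]
      calc _ ≤ (2 * l + 1) * (2 * b + 5) :=
            Nat.mul_le_mul_left _ ((Nat.le_of_dvd (by omega) hdvd).trans (by omega))
        _ = _ := hN.symm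
    · push Not at ht
      obtain ⟨i, hi⟩ := ht
      refine le_hammingWt_of_ne_translate hN (t := a + 3) (i := i) ?_ (fun j => ?_) ?_
      · intro h
        have e : a + 3 = (2 * b + 5) * l + 2 := by linarith
        rw [e, Nat.dvd_add_right (Dvd.intro _ rfl)] at h
        have := Nat.le_of_dvd (by norm_num) h
        omega
      · have h1 := hsym (j + (2 * b + 5 : ℕ))
        have h2 := hsym (j + (2 * b + 5 : ℕ) + (a + 1 : ℕ))
        have e : j + ((2 * b + 5 : ℕ) : ZMod (2 * (a + b) + 7)) + (a + 1 : ℕ) + (a + 1 : ℕ) = j := by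
          push_cast at hzero ⊢
          linear_combination hzero
        rw [e] at h2
        rw [← h1, ← h2]
      · rw [ne_eq, CharTwo.add_eq_zero]
        exact hi.symm
end

section
/- Let l ≥ 1, b = 3l − 1, and let a be a natural number with a ≡ 0 (mod 3) and a ≥ 3(l−1); set N = 2(a+b)+7. Then there exist vectors e_x, e_z : ZMod N → F_2 such that: (i) H_x *ᵥ e_z + H_z *ᵥ e_x = 0 over F_2; (ii) the supports of e_x and e_z both have odd cardinality; and (iii) the union of the supports of e_x and e_z has cardinality 2b+3 (= 6l+1). (Hence the quantum XYZ cyclic code C(a,b) has a Y-type logical operator of weight 2b+3, so the minimum weight of a Y-type logical operator is at most 2b+3.) -/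
open Matrix

/-- The support of a vector `v : ZMod N → F_2`: the finite set of indices `i` with `v i ≠ 0`. -/
def supp {N : ℕ} [NeZero N] (v : ZMod N → ZMod 2) : Finset (ZMod N) :=
  Finset.univ.filter fun i => v i ≠ 0

/-- A circulant matrix with indicator symbol sends a basis vector to the indicator of the
translated symbol set. -/
lemma circulant_indicator_mulVec_single {G : Type*} [AddCommGroup G] [Fintype G] [DecidableEq G]
    (S : Finset G) (t : G) :
    (Matrix.circulant fun i => if i ∈ S then (1 : ZMod 2) else 0) *ᵥ Pi.single t 1 =
      ∑ s ∈ S, Pi.single (t + s) 1 := by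
  ext i
  simp only [Matrix.mulVec_single_one, Matrix.col_apply, Matrix.circulant_apply,
    Finset.sum_apply, Pi.single_apply]
  simp only [← sub_eq_iff_eq_add', Finset.sum_ite_eq]

/-- A sum of basis vectors over distinct indices is supported exactly on these indices. -/
lemma supp_sum_single {N : ℕ} [NeZero N] {ι : Type*} (A : Finset ι)
    (f : ι → ZMod N) (hf : Set.InjOn f A) :
    supp (∑ k ∈ A, Pi.single (f k) 1) = A.image f := by
  rw [← Finset.sum_image (f := fun j => (Pi.single j 1 : ZMod N → ZMod 2)) hf]
  ext i
  simp [supp, Finset.sum_apply, Pi.single_apply]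

lemma natCast_ne_natCast {N m n : ℕ} (hm : m < N) (hn : n < N) (h : m ≠ n) :
    (m : ZMod N) ≠ n := by
  rwa [Ne, ZMod.natCast_eq_natCast_iff', Nat.mod_eq_of_lt hm, Nat.mod_eq_of_lt hn]

lemma circulant_indicator_four_mulVec_single {N : ℕ} [NeZero N] {p q r s : ℕ} (hpq : p < q)
    (hqr : q < r) (hrs : r < s) (hs : s < N) (t : ZMod N) :
    (Matrix.circulant fun i =>
      if i ∈ ({(p : ZMod N), (q : ZMod N), (r : ZMod N), (s : ZMod N)} : Finset (ZMod N))
      then (1 : ZMod 2) else 0) *ᵥ Pi.single t 1 =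
      Pi.single (t + p) 1 + Pi.single (t + q) 1 + Pi.single (t + r) 1 + Pi.single (t + s) 1 := by
  have hne {m n : ℕ} (hmn : m < n) (hn : n < N) : (m : ZMod N) ≠ n :=
    natCast_ne_natCast (hmn.trans hn) hn hmn.ne
  rw [circulant_indicator_mulVec_single, Finset.sum_insert, Finset.sum_insert,
    Finset.sum_insert, Finset.sum_singleton, ← add_assoc, ← add_assoc]
  · simpa using hne hrs hs
  · simpa using ⟨hne hqr (hrs.trans hs), hne (hqr.trans hrs) hs⟩
  · simpa using ⟨hne hpq (hqr.trans (hrs.trans hs)), hne (hpq.trans hqr) (hrs.trans hs),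
      hne (hpq.trans (hqr.trans hrs)) hs⟩

/-- The basis vector at `k / 2`, where `a + b + 4` is the inverse of `2` modulo
`2 (a + b) + 7`. -/
def halfSingle (a b : ℕ) (k : ℤ) : ZMod (2 * (a + b) + 7) → ZMod 2 :=
  Pi.single ((a + b + 4 : ℕ) * (k : ZMod (2 * (a + b) + 7))) 1

lemma two_mul_half (a b : ℕ) :
    2 * ((a + b + 4 : ℕ) : ZMod (2 * (a + b) + 7)) = 1 := by
  have h := ZMod.natCast_self (2 * (a + b) + 7)
  push_cast at h ⊢
  linear_combination h

lemma single_half_add {a b : ℕ} (k : ℤ) (c : ℕ) {d : ℤ} (m : ℤ)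
    (h : d = 2 * c + m * (2 * (a + b) + 7 : ℕ)) :
    Pi.single (((a + b + 4 : ℕ) : ZMod (2 * (a + b) + 7)) * (k : ZMod (2 * (a + b) + 7)) + c) 1 =
      halfSingle a b (k + d) := by
  have hd : (d : ZMod (2 * (a + b) + 7)) = 2 * c := by
    rw [h, Int.cast_add, Int.cast_mul m, Int.cast_natCast, ZMod.natCast_self, mul_zero, add_zero]
    push_cast
    rfl
  rw [halfSingle, Int.cast_add, hd]
  congr 1
  linear_combination (-(c : ZMod (2 * (a + b) + 7))) * two_mul_half a b

lemma Hx_mulVec_halfSingle (a b : ℕ) (k : ℤ) :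
    Hx a b *ᵥ halfSingle a b k = halfSingle a b k + halfSingle a b (k + -3) +
      halfSingle a b (k + 1) + halfSingle a b (k + -2) := by
  rw [Hx, halfSingle, circulant_indicator_four_mulVec_single (by omega) (by omega) (by omega)
      (by omega), single_half_add k 0 (d := 0) 0 (by simp),
    single_half_add k (a + b + 2) (d := -3) (-1) (by push_cast; ring),
    single_half_add k (a + b + 4) (d := 1) (-1) (by push_cast; ring),
    single_half_add k (2 * (a + b) + 6) (d := -2) (-2) (by push_cast; ring), add_zero]
  rfl

lemma Hz_mulVec_halfSingle (a b : ℕ) (k : ℤ) :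
    Hz a b *ᵥ halfSingle a b k = halfSingle a b (k + (2 * b + 2)) + halfSingle a b (k + -3) +
      halfSingle a b (k + 1) + halfSingle a b (k + (-2 * b - 4)) := by
  rw [Hz, halfSingle, circulant_indicator_four_mulVec_single (by omega) (by omega) (by omega)
      (by omega), single_half_add k (b + 1) (d := 2 * b + 2) 0 (by push_cast; ring),
    single_half_add k (a + b + 2) (d := -3) (-1) (by push_cast; ring),
    single_half_add k (a + b + 4) (d := 1) (-1) (by push_cast; ring),
    single_half_add k (2 * a + b + 5) (d := -2 * b - 4) (-2) (by push_cast; ring)]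

lemma halfSingle_injOn (a b : ℕ) (A : Finset ℤ)
    (hA : ∀ k ∈ A, 2 * k.natAbs < 2 * (a + b) + 7) :
    Set.InjOn (fun k : ℤ => ((a + b + 4 : ℕ) : ZMod (2 * (a + b) + 7)) * k) A := by
  intro j hj k hk hjk
  have h2 := two_mul_half a b
  have hcast : (j : ZMod (2 * (a + b) + 7)) = k := by
    linear_combination 2 * hjk + (k - j : ZMod (2 * (a + b) + 7)) * h2
  have hdvd := (ZMod.intCast_eq_intCast_iff_dvd_sub j k _).1 hcast
  have hzero := Int.eq_zero_of_abs_lt_dvd hdvd (by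
    have := hA j hj
    have := hA k hk
    rw [abs_lt]
    omega)
  omega

/-- The integers `2 * i` for `i` in the support of the `Z`-part of the logical operator: `0` and
the integers `k` with `|k| < 6 * l` and `|k|` congruent to `3`, `4` or `5` modulo `6`. -/
noncomputable def halfSupport (l : ℕ) : Finset ℤ :=
  {k ∈ Finset.Ioo (-(6 * l + 1) : ℤ) (6 * l + 1) | k = 0 ∨ 3 ≤ k.natAbs % 6}

/-- The half-indices in `halfSupport (l + 1)` that are not in `halfSupport l`. -/
def halfShell (l : ℕ) : Finset ℤ :=
  {6 * (l : ℤ) + 3, 6 * (l : ℤ) + 4, 6 * (l : ℤ) + 5,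
    -(6 * (l : ℤ) + 3), -(6 * (l : ℤ) + 4), -(6 * (l : ℤ) + 5)}

lemma halfSupport_zero : halfSupport 0 = {0} := by decide

lemma halfSupport_succ (l : ℕ) : halfSupport (l + 1) = halfSupport l ∪ halfShell l := by
  ext k
  simp only [halfSupport, halfShell, Finset.mem_union, Finset.mem_filter, Finset.mem_Ioo,
    Finset.mem_insert, Finset.mem_singleton]
  push_cast
  omega

lemma disjoint_halfSupport_halfShell (l : ℕ) : Disjoint (halfSupport l) (halfShell l) := by
  rw [Finset.disjoint_left]
  intro k
  simp only [halfSupport, halfShell, Finset.mem_filter, Finset.mem_Ioo,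
    Finset.mem_insert, Finset.mem_singleton]
  omega

lemma sum_halfShell {M : Type*} [AddCommMonoid M] (l : ℕ) (f : ℤ → M) :
    ∑ k ∈ halfShell l, f k = f (6 * l + 3) + (f (6 * l + 4) + (f (6 * l + 5) +
      (f (-(6 * l + 3)) + (f (-(6 * l + 4)) + f (-(6 * l + 5)))))) := by
  rw [halfShell, Finset.sum_insert, Finset.sum_insert, Finset.sum_insert, Finset.sum_insert,
    Finset.sum_insert, Finset.sum_singleton]
  all_goals
    simp only [Finset.mem_insert, Finset.mem_singleton]
    omega

lemma card_halfSupport (l : ℕ) : (halfSupport l).card = 6 * l + 1 := by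
  induction l with
  | zero => rw [halfSupport_zero]; rfl
  | succ l ih =>
    rw [halfSupport_succ, Finset.card_union_of_disjoint (disjoint_halfSupport_halfShell l), ih,
      Finset.card_eq_sum_ones, sum_halfShell]
    ring

lemma zero_mem_halfSupport (l : ℕ) : 0 ∈ halfSupport l := by
  simp only [halfSupport, Finset.mem_filter, Finset.mem_Ioo]
  exact ⟨by omega, Or.inl trivial⟩

lemma natAbs_lt_of_mem_halfSupport {l : ℕ} (hl : 1 ≤ l) {k : ℤ} (hk : k ∈ halfSupport l) :
    k.natAbs < 6 * l := by
  simp only [halfSupport, Finset.mem_filter, Finset.mem_Ioo] at hk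
  omega

/-- The sum over `halfSupport l` telescopes under `Hx`. -/
lemma Hx_mulVec_sum_halfSupport (a b l : ℕ) :
    Hx a b *ᵥ ∑ k ∈ halfSupport l, halfSingle a b k =
      halfSingle a b (6 * l) + halfSingle a b (-3) + halfSingle a b 1 +
        halfSingle a b (-6 * l - 2) := by
  induction l with
  | zero => simp [halfSupport_zero, Hx_mulVec_halfSingle]
  | succ l ih =>
    rw [halfSupport_succ, Finset.sum_union (disjoint_halfSupport_halfShell l), Matrix.mulVec_add,
      ih, sum_halfShell]
    simp only [Matrix.mulVec_add, Hx_mulVec_halfSingle]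
    ext i
    simp only [Pi.add_apply]
    push_cast
    ring_nf
    reduce_mod_char

/-- Let `l ≥ 1`, `b = 3l − 1`, and `a ≡ 0 (mod 3)` with `a ≥ 3(l−1)`; set `N = 2(a+b)+7`.
Then there exist `e_x, e_z : ZMod N → F_2` such that (i) `H_x *ᵥ e_z + H_z *ᵥ e_x = 0`;
(ii) the supports of `e_x` and `e_z` both have odd cardinality; and (iii) the union of the
supports has cardinality `2b+3 (= 6l+1)`. Hence `C(a,b)` has a `Y`-type logical operator of
weight `2b+3`, so the minimum weight of a `Y`-type logical operator is at most `2b+3`. -/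
theorem xyz_logical_Y_weight_upper_bound_b_eq_3l_sub_one (l : ℕ) (hl : 1 ≤ l) (b : ℕ)
    (hb : b = 3 * l - 1) (a : ℕ) (ha3 : a % 3 = 0) (ha : 3 * (l - 1) ≤ a) :
    ∃ ex ez : ZMod (2 * (a + b) + 7) → ZMod 2,
      Hx a b *ᵥ ez + Hz a b *ᵥ ex = 0 ∧
      Odd (supp ex).card ∧ Odd (supp ez).card ∧
      (supp ex ∪ supp ez).card = 2 * b + 3 := by
  have hN : ∀ k ∈ halfSupport l, 2 * k.natAbs < 2 * (a + b) + 7 := by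
    intro k hk
    have := natAbs_lt_of_mem_halfSupport hl hk
    omega
  have hinj := halfSingle_injOn a b (halfSupport l) hN
  have hz : supp (∑ k ∈ halfSupport l, halfSingle a b k) =
      (halfSupport l).image fun k : ℤ => ((a + b + 4 : ℕ) : ZMod (2 * (a + b) + 7)) * k :=
    supp_sum_single _ _ hinj
  have hx : supp (halfSingle a b 0) = {0} := by
    ext i
    simp [supp, halfSingle, Pi.single_apply]
  have hcard : (supp (∑ k ∈ halfSupport l, halfSingle a b k)).card = 6 * l + 1 := by
    rw [hz, Finset.card_image_of_injOn hinj, card_halfSupport]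
  refine ⟨halfSingle a b 0, ∑ k ∈ halfSupport l, halfSingle a b k, ?_, ?_, ?_, ?_⟩
  · have h1 : (0 : ℤ) + (2 * b + 2) = 6 * l := by omega
    have h2 : (0 : ℤ) + (-2 * b - 4) = -6 * l - 2 := by omega
    rw [Hx_mulVec_sum_halfSupport, Hz_mulVec_halfSingle, h1, h2, zero_add, zero_add]
    exact CharTwo.add_self_eq_zero _
  · simp [hx]
  · rw [hcard]
    exact ⟨3 * l, by ring⟩
  · rw [Finset.union_eq_right.2, hcard]
    · omega
    · rw [hx, hz, Finset.singleton_subset_iff, Finset.mem_image]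
      exact ⟨0, zero_mem_halfSupport l, by simp⟩
end
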